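/- arXiv:1908.07501 — 4 statements merged into one kernel-verified Lean document; each statement's English description precedes it below -/
import Mathlib

section
/- Let α_1,…,α_r, β_1,…,β_r be real numbers with α_i − β_j ∉ ℤ for all i, j. Fix an index i₀ such that β_j − β_{i₀} is not a negative integer for any j, and set ρ = 1 − β_{i₀}. For n ∈ ℕ define a_n(s) = (∏_{j=1}^r ∏_{k=0}^{n−1}(s+α_j+k)) / (∏_{j=1}^r ∏_{k=0}^{n−1}(s+β_j+k)); these are analytic in s in a neighbourhood of ρ, and a_n(ρ) ≠ 0. Then for every k ≥ 0 the limit λ_k := lim_{n→∞} (d^k/ds^k a_n)(ρ) / (k! · a_n(ρ)) exists and equals the k-th Taylor coefficient at s = ρ of the function s ↦ A(ρ)/A(s), i.e. λ_k = (1/k!) · (d^k/ds^k)(A(ρ)/A(s)) |_{s=ρ}. -/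
open Finset Filter

/-- The gamma product `A(s) = ∏ Γ(s+α_j) / ∏ Γ(s+β_j)`. -/
noncomputable def hgA (r : ℕ) (α β : Fin r → ℝ) (s : ℂ) : ℂ :=
  (∏ j, Complex.Gamma (s + (α j : ℂ))) / (∏ j, Complex.Gamma (s + (β j : ℂ)))

/-- The hypergeometric Frobenius coefficient
`a_n(s) = ∏_j ∏_{k<n} (s+α_j+k) / ∏_j ∏_{k<n} (s+β_j+k)`. -/
noncomputable def hgCoef (r : ℕ) (α β : Fin r → ℝ) (n : ℕ) (s : ℂ) : ℂ :=
  (∏ j, ∏ k ∈ range n, (s + (α j : ℂ) + (k : ℂ))) /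
    (∏ j, ∏ k ∈ range n, (s + (β j : ℂ) + (k : ℂ)))

open Topology in
/-- Pointwise limit of the normalised ratio of Pochhammer products. -/
lemma hg_pointwise (a b ρ s : ℂ) (h1 : ∀ k : ℕ, s + a + k ≠ 0)
    (h4 : ∀ k : ℕ, ρ + b + k ≠ 0) :
    Tendsto (fun n : ℕ => (∏ k ∈ range n, (s + a + k)) * (∏ k ∈ range n, (ρ + b + k)) /
      ((∏ k ∈ range n, (s + b + k)) * (∏ k ∈ range n, (ρ + a + k)))) atTop
      (𝓝 (Complex.Gamma (s + b) * Complex.Gamma (ρ + a) /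
        (Complex.Gamma (s + a) * Complex.Gamma (ρ + b)))) := by
  have ne : ∀ z : ℂ, (∀ k : ℕ, z + k ≠ 0) → Complex.Gamma z ≠ 0 := fun z hz =>
    Complex.Gamma_ne_zero fun m hm => hz m (by rw [hm]; ring)
  rw [← tendsto_add_atTop_iff_nat 1]
  have key := ((Complex.GammaSeq_tendsto_Gamma (s + b)).mul
    (Complex.GammaSeq_tendsto_Gamma (ρ + a))).div
    ((Complex.GammaSeq_tendsto_Gamma (s + a)).mul (Complex.GammaSeq_tendsto_Gamma (ρ + b)))
    (mul_ne_zero (ne _ h1) (ne _ h4))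
  refine key.congr' ?_
  filter_upwards [eventually_ne_atTop 0] with n hn
  have hn' : (n : ℂ) ≠ 0 := Nat.cast_ne_zero.mpr hn
  have hf : (n.factorial : ℂ) ≠ 0 := Nat.cast_ne_zero.mpr n.factorial_ne_zero
  have p : ∀ z : ℂ, (n : ℂ) ^ z ≠ 0 := fun z => by simp [Complex.cpow_eq_zero_iff, hn']
  have e : (n : ℂ) ^ (s + b) * (n : ℂ) ^ (ρ + a) = (n : ℂ) ^ (s + a) * (n : ℂ) ^ (ρ + b) := by
    rw [← Complex.cpow_add _ _ hn', ← Complex.cpow_add _ _ hn']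
    congr 1; ring
  simp only [Pi.div_apply, Complex.GammaSeq]
  have p1 := p (s + a)
  have p2 := p (ρ + b)
  generalize (n : ℂ) ^ (s + a) = x1 at *
  generalize (n : ℂ) ^ (ρ + b) = x2 at *
  generalize (n : ℂ) ^ (s + b) = x3 at *
  generalize (n : ℂ) ^ (ρ + a) = x4 at *
  generalize (∏ k ∈ range (n + 1), (s + a + k)) = y1
  generalize (∏ k ∈ range (n + 1), (ρ + b + k)) = y2
  generalize (∏ k ∈ range (n + 1), (s + b + k)) = y3
  generalize (∏ k ∈ range (n + 1), (ρ + a + k)) = y4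
  generalize (n.factorial : ℂ) = f at *
  calc x3 * f / y3 * (x4 * f / y4) / (x1 * f / y1 * (x2 * f / y2))
      = ((x3 * x4) * f * f) / ((x1 * x2) * f * f) * (y1 * y2 / (y3 * y4)) := by
        simp only [div_eq_mul_inv, mul_inv, inv_inv]; ring
    _ = _ := by rw [e, div_self (by simp [p1, p2, hf]), one_mul]

open Topology in
/-- Locally uniform version. -/
lemma hg_locunif (a b ρ : ℂ) (U : Set ℂ) (hU : IsOpen U) (hρ : ρ ∈ U)
    (hb : U ⊆ Metric.ball ρ 1)
    (h1 : ∀ s ∈ U, ∀ k : ℕ, s + a + k ≠ 0) (h2 : ∀ s ∈ U, ∀ k : ℕ, s + b + k ≠ 0) :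
    TendstoLocallyUniformlyOn
      (fun (n : ℕ) (s : ℂ) => (∏ k ∈ range n, (s + a + k)) * (∏ k ∈ range n, (ρ + b + k)) /
      ((∏ k ∈ range n, (s + b + k)) * (∏ k ∈ range n, (ρ + a + k))))
      (fun s => Complex.Gamma (s + b) * Complex.Gamma (ρ + a) /
        (Complex.Gamma (s + a) * Complex.Gamma (ρ + b))) atTop U := by
  have hsum : Summable (fun k : ℕ => 4 * ‖b - a‖ * (1 / (k : ℝ) ^ 2)) :=
    (Real.summable_one_div_nat_pow.mpr (by norm_num)).mul_left _
  have T := (hsum.hasProdLocallyUniformlyOn_nat_one_add (K := U)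
    (f := fun (k : ℕ) (s : ℂ) => (s - ρ) * (b - a) / ((s + b + k) * (ρ + a + k))) hU ?_
    ?_).tendstoLocallyUniformlyOn_finsetRange
  · have T2 : TendstoLocallyUniformlyOn
      (fun (n : ℕ) (s : ℂ) => (∏ k ∈ range n, (s + a + k)) * (∏ k ∈ range n, (ρ + b + k)) /
      ((∏ k ∈ range n, (s + b + k)) * (∏ k ∈ range n, (ρ + a + k))))
      (fun s => ∏' k : ℕ, (1 + (s - ρ) * (b - a) / ((s + b + k) * (ρ + a + k)))) atTop U := by
      refine T.congr ?_
      intro n s hs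
      simp only
      rw [← Finset.prod_mul_distrib, ← Finset.prod_mul_distrib, ← Finset.prod_div_distrib]
      refine Finset.prod_congr rfl fun k _ => ?_
      have := h2 s hs k
      have := h1 ρ hρ k
      field_simp
      ring
    refine T2.congr_right ?_
    intro s hs
    exact tendsto_nhds_unique (T2.tendsto_at hs)
      (hg_pointwise a b ρ s (h1 s hs) (h2 ρ hρ))
  · obtain ⟨N, hN⟩ := exists_nat_gt (2 * (‖ρ‖ + 1 + ‖a‖ + ‖b‖))
    filter_upwards [eventually_ge_atTop (N + 1)] with k hk s hs
    have hk' : (N : ℝ) + 1 ≤ k := by exact_mod_cast hk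
    have hds : ‖s - ρ‖ < 1 := by simpa [dist_eq_norm] using hb hs
    have ha0 := norm_nonneg a
    have hb0 := norm_nonneg b
    have hr0 := norm_nonneg ρ
    have kpos : (0 : ℝ) < k := by linarith
    have lower : ∀ z : ℂ, ‖z‖ ≤ ‖ρ‖ + 1 + ‖a‖ + ‖b‖ → (k : ℝ) / 2 ≤ ‖z + k‖ := by
      intro z hz
      have h := norm_sub_le (z + k) z
      have e : z + k - z = (k : ℂ) := by ring
      rw [e, Complex.norm_natCast] at h
      linarith
    have l1 := lower (s + b) (by
      have e : s + b = (s - ρ) + ρ + b := by ring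
      rw [e]
      have := norm_add₃_le (a := s - ρ) (b := ρ) (c := b)
      linarith)
    have l2 := lower (ρ + a) (by
      have := norm_add_le ρ a
      linarith)
    rw [norm_div, norm_mul, norm_mul]
    calc ‖s - ρ‖ * ‖b - a‖ / (‖s + b + k‖ * ‖ρ + a + k‖)
        ≤ 1 * ‖b - a‖ / ((k : ℝ) / 2 * ((k : ℝ) / 2)) := by gcongr
      _ = _ := by field_simp; ring
  · intro k s hs
    have := h2 s hs k
    have := h1 ρ hρ k
    exact ContinuousAt.continuousWithinAt
      (by refine ContinuousAt.div (by fun_prop) (by fun_prop) (by simp [*]))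

/-- Products of locally uniformly convergent sequences. -/
lemma hg_tlu_prod {ι : Type*} (t : Finset ι) (F : ι → ℕ → ℂ → ℂ) (f : ι → ℂ → ℂ) (U : Set ℂ)
    (h : ∀ j, TendstoLocallyUniformlyOn (F j) (f j) atTop U) (hc : ∀ j, ContinuousOn (f j) U) :
    TendstoLocallyUniformlyOn (fun n s => ∏ j ∈ t, F j n s) (fun s => ∏ j ∈ t, f j s) atTop U := by
  classical
  induction t using Finset.induction_on with
  | empty =>
    simp only [Finset.prod_empty]
    intro u hu x _
    exact ⟨Set.univ, univ_mem, Eventually.of_forall fun n y _ => refl_mem_uniformity hu⟩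
  | insert i t hi ih =>
    simp only [Finset.prod_insert hi]
    exact (h i).mul₀ ih (hc i) (continuousOn_finsetProd _ fun j _ => hc j)

open Topology in
/-- Iterated derivatives converge. -/
lemma hg_tlu_iter (F : ℕ → ℂ → ℂ) (f : ℂ → ℂ) (U : Set ℂ) (hU : IsOpen U)
    (h : TendstoLocallyUniformlyOn F f atTop U) (hd : ∀ n, DifferentiableOn ℂ (F n) U) (k : ℕ) :
    TendstoLocallyUniformlyOn (fun n => iteratedDeriv k (F n)) (iteratedDeriv k f) atTop U ∧
    ∀ n, DifferentiableOn ℂ (iteratedDeriv k (F n)) U := by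
  induction k with
  | zero => simpa only [iteratedDeriv_zero] using ⟨h, hd⟩
  | succ k ih =>
    simp only [iteratedDeriv_succ]
    exact ⟨ih.1.deriv (Eventually.of_forall ih.2) hU, fun n => (ih.2 n).deriv hU⟩

/-- The limits `λ_k = lim_n a_n^{(k)}(ρ)/(k!·a_n(ρ))` exist and are the Taylor
coefficients of `A(ρ)/A(s)` at `s = ρ`. -/
theorem stmt5 (r : ℕ) (hr : 1 ≤ r) (α β : Fin r → ℝ)
    (hirr : ∀ i j, ¬ ∃ m : ℤ, α i - β j = (m : ℝ))
    (i₀ : Fin r)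
    (hi₀ : ∀ j, ¬ ∃ m : ℤ, m < 0 ∧ β j - β i₀ = (m : ℝ))
    (ρ : ℂ) (hρ : ρ = 1 - (β i₀ : ℂ)) :
    (∀ n : ℕ, AnalyticAt ℂ (hgCoef r α β n) ρ) ∧
    (∀ n : ℕ, hgCoef r α β n ρ ≠ 0) ∧
    (∀ k : ℕ, Tendsto
        (fun n : ℕ =>
          iteratedDeriv k (hgCoef r α β n) ρ / ((k.factorial : ℂ) * hgCoef r α β n ρ))
        atTop
        (nhds ((k.factorial : ℂ)⁻¹ *
          iteratedDeriv k (fun s => hgA r α β ρ / hgA r α β s) ρ))) := by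
  have hβ : ∀ j, ∀ k : ℕ, ρ + (β j : ℂ) + k ≠ 0 := by
    intro j k h
    refine hi₀ j ⟨-(k + 1 : ℤ), by omega, ?_⟩
    rw [hρ] at h
    have h' : ((1 - β i₀ + β j + k : ℝ) : ℂ) = 0 := by push_cast; exact h
    have h'' := Complex.ofReal_eq_zero.mp h'
    push_cast
    linarith
  have hα : ∀ j, ∀ k : ℕ, ρ + (α j : ℂ) + k ≠ 0 := by
    intro j k h
    refine hirr j i₀ ⟨-(k + 1 : ℤ), ?_⟩
    rw [hρ] at h
    have h' : ((1 - β i₀ + α j + k : ℝ) : ℂ) = 0 := by push_cast; exact h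
    have h'' := Complex.ofReal_eq_zero.mp h'
    push_cast
    linarith
  have hdiff : ∀ n : ℕ, ∀ s : ℂ, (∀ j, ∀ k : ℕ, s + (β j : ℂ) + k ≠ 0) →
      AnalyticAt ℂ (hgCoef r α β n) s := by
    intro n s hs
    unfold hgCoef
    refine AnalyticAt.fun_div ?_ ?_ ?_
    · exact Finset.analyticAt_fun_prod _ fun j _ => Finset.analyticAt_fun_prod _ fun k _ => by fun_prop
    · exact Finset.analyticAt_fun_prod _ fun j _ => Finset.analyticAt_fun_prod _ fun k _ => by fun_prop
    · exact Finset.prod_ne_zero_iff.2 fun j _ => Finset.prod_ne_zero_iff.2 fun k _ => hs j k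
  have hne : ∀ n : ℕ, hgCoef r α β n ρ ≠ 0 := by
    intro n
    unfold hgCoef
    exact div_ne_zero
      (Finset.prod_ne_zero_iff.2 fun j _ => Finset.prod_ne_zero_iff.2 fun k _ => hα j k)
      (Finset.prod_ne_zero_iff.2 fun j _ => Finset.prod_ne_zero_iff.2 fun k _ => hβ j k)
  refine ⟨fun n => hdiff n ρ hβ, hne, fun k => ?_⟩
  have gz : ∀ z : ℂ, (Complex.Gamma z)⁻¹ ≠ 0 ↔ ∀ k : ℕ, z + k ≠ 0 := by
    intro z
    rw [ne_eq, inv_eq_zero, Complex.Gamma_eq_zero_iff]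
    push Not
    exact forall_congr' fun m => by rw [ne_eq, ne_eq, eq_neg_iff_add_eq_zero]
  set g : ℂ → ℂ := fun s => (∏ j, (Complex.Gamma (s + (α j : ℂ)))⁻¹) *
    ∏ j, (Complex.Gamma (s + (β j : ℂ)))⁻¹ with hg
  have gc : Continuous g := by
    have c := Complex.differentiable_one_div_Gamma.continuous
    refine Continuous.mul ?_ ?_
    · exact continuous_finsetProd _ fun j _ => c.comp (by fun_prop : Continuous fun s : ℂ => s + (α j : ℂ))
    · exact continuous_finsetProd _ fun j _ => c.comp (by fun_prop : Continuous fun s : ℂ => s + (β j : ℂ))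
  have gne : ∀ s, g s ≠ 0 ↔ (∀ j, ∀ k : ℕ, s + (α j : ℂ) + k ≠ 0) ∧
      (∀ j, ∀ k : ℕ, s + (β j : ℂ) + k ≠ 0) := by
    intro s
    simp only [hg, mul_ne_zero_iff, Finset.prod_ne_zero_iff, gz, Finset.mem_univ, true_imp_iff]
  set U : Set ℂ := {s | g s ≠ 0} ∩ Metric.ball ρ 1 with hUdef
  have hU : IsOpen U := (isOpen_ne_fun gc continuous_const).inter Metric.isOpen_ball
  have hρU : ρ ∈ U := ⟨(gne ρ).2 ⟨hα, hβ⟩, Metric.mem_ball_self one_pos⟩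
  have hUα : ∀ j, ∀ s ∈ U, ∀ k : ℕ, s + (α j : ℂ) + k ≠ 0 := fun j s hs => ((gne s).1 hs.1).1 j
  have hUβ : ∀ j, ∀ s ∈ U, ∀ k : ℕ, s + (β j : ℂ) + k ≠ 0 := fun j s hs => ((gne s).1 hs.1).2 j
  have T := hg_tlu_prod Finset.univ _ _ U (fun j => hg_locunif (α j) (β j) ρ U hU hρU
    Set.inter_subset_right (hUα j) (hUβ j)) (by
      intro j s hs
      have n1 := (gz _).2 (hUα j s hs)
      have n2 := (gz _).2 (hβ j)
      have cg : ∀ c : ℂ, (∀ k : ℕ, s + c + k ≠ 0) →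
          ContinuousAt (fun s => Complex.Gamma (s + c)) s := fun c hc =>
        ContinuousAt.comp (f := fun s => s + c) (g := Complex.Gamma)
          (Complex.continuousAt_Gamma _ fun m hm => hc m (by rw [hm]; ring)) (by fun_prop)
      refine ContinuousAt.continuousWithinAt (ContinuousAt.div ((cg _ (hUβ j s hs)).mul_const _)
        ((cg _ (hUα j s hs)).mul_const _) ?_)
      exact mul_ne_zero (fun h => n1 (by rw [h, inv_zero])) (fun h => n2 (by rw [h, inv_zero])))
  have T1 : TendstoLocallyUniformlyOn (fun n s => hgCoef r α β n s / hgCoef r α β n ρ)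
      (fun s => hgA r α β ρ / hgA r α β s) atTop U := by
    refine (T.congr ?_).congr_right ?_
    · intro n s _
      simp only [hgCoef, Finset.prod_div_distrib, Finset.prod_mul_distrib]
      rw [div_div_div_eq]
    · intro s _
      simp only [hgA, Finset.prod_div_distrib, Finset.prod_mul_distrib]
      rw [div_div_div_eq]
      ring
  have T2 := (hg_tlu_iter _ _ U hU T1 (fun n s hs =>
    ((hdiff n s fun j => hUβ j s hs).differentiableAt.div_const _).differentiableWithinAt) k).1
  have T3 := (T2.tendsto_at hρU).const_mul ((k.factorial : ℂ)⁻¹)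
  refine T3.congr fun n => ?_
  rw [iteratedDeriv_div_const]
  simp only [div_eq_mul_inv, mul_inv]
  ring
end

section
/- Let α_1,…,α_r, β_1,…,β_r be real numbers. Then, as x → +∞ along the reals, log A(x) − (Σ_{j=1}^r α_j − Σ_{j=1}^r β_j) · log x = O(1/x); that is, the function x ↦ log A(x) − (Σα_j − Σβ_j)·log x is big-O of x⁻¹ along the filter atTop on ℝ (here A(x) > 0 for all sufficiently large real x, so the logarithm is defined). -/
open Finset Filter Asymptotics

/-- The real gamma product `A(x) = ∏ Γ(x+α_j) / ∏ Γ(x+β_j)`. -/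
noncomputable def hgAReal (r : ℕ) (α β : Fin r → ℝ) (x : ℝ) : ℝ :=
  (∏ j, Real.Gamma (x + α j)) / (∏ j, Real.Gamma (x + β j))

lemma aux_log (a : ℝ) :
    (fun x : ℝ => Real.log (x + a) - Real.log x) =O[atTop] (fun x : ℝ => x⁻¹) := by
  have hd : HasDerivAt Real.log (1:ℝ)⁻¹ 1 := Real.hasDerivAt_log one_ne_zero
  have h1 := hd.isBigO_sub
  have ht : Tendsto (fun x : ℝ => 1 + a * x⁻¹) atTop (nhds 1) := by
    have := (tendsto_inv_atTop_zero (𝕜 := ℝ)).const_mul a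
    simpa using this.const_add 1
  have h2 := h1.comp_tendsto ht
  have h3 : (fun x : ℝ => a * x⁻¹) =O[atTop] (fun x : ℝ => x⁻¹) :=
    isBigO_const_mul_self a _ _
  have h4 : ((fun x : ℝ => x - 1) ∘ fun x : ℝ => 1 + a * x⁻¹) = fun x : ℝ => a * x⁻¹ := by
    funext x; simp
  rw [h4] at h2
  refine (h2.trans h3).congr' ?_ EventuallyEq.rfl
  filter_upwards [eventually_gt_atTop 0, eventually_gt_atTop (-a)] with x hx hxa
  have hxa' : x + a ≠ 0 := by linarith
  simp only [Function.comp, Real.log_one, sub_zero]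
  rw [← Real.log_div hxa' hx.ne']
  congr 1
  field_simp

lemma aux_Gamma_step {x : ℝ} (hx : 0 < x) :
    Real.log (Real.Gamma (x + 1)) = Real.log x + Real.log (Real.Gamma x) := by
  rw [Real.Gamma_add_one hx.ne', Real.log_mul hx.ne' (Real.Gamma_pos_of_pos hx).ne']

lemma aux_unit (a : ℝ) (h0 : 0 ≤ a) (h1 : a ≤ 1) :
    (fun x : ℝ => Real.log (Real.Gamma (x + a)) - Real.log (Real.Gamma x) - a * Real.log x)
      =O[atTop] (fun x : ℝ => x⁻¹) := by
  refine IsBigO.trans (IsBigO.of_bound 1 ?_) (aux_log (-1))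
  filter_upwards [eventually_gt_atTop 1] with x hx
  have hx0 : 0 < x := by linarith
  have hc := Real.convexOn_log_Gamma
  have hup := hc.2 (x := x) (y := x + 1) hx0 (show 0 < x + 1 by linarith)
    (sub_nonneg.2 h1) h0 (by ring)
  have hlo := hc.2 (x := x - 1) (y := x + a) (show 0 < x - 1 by linarith)
    (show 0 < x + a by linarith)
    (show 0 ≤ a / (1 + a) by positivity) (show 0 ≤ 1 / (1 + a) by positivity)
    (by field_simp; ring)
  have e1 : (1 - a) • x + a • (x + 1) = x + a := by simp only [smul_eq_mul]; ring
  have e2 : (a / (1 + a)) • (x - 1) + (1 / (1 + a)) • (x + a) = x := by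
    simp only [smul_eq_mul]; field_simp; ring
  rw [e1] at hup
  rw [e2] at hlo
  simp only [Function.comp, smul_eq_mul] at hup hlo
  have hs1 := aux_Gamma_step hx0
  have hs2 := aux_Gamma_step (show 0 < x - 1 by linarith)
  rw [sub_add_cancel] at hs2
  have hlo' : (1 + a) * Real.log (Real.Gamma x) ≤
      a * Real.log (Real.Gamma (x - 1)) + Real.log (Real.Gamma (x + a)) := by
    have := mul_le_mul_of_nonneg_left hlo (show 0 ≤ 1 + a by linarith)
    refine this.trans (le_of_eq ?_)
    field_simp
  rw [hs1] at hup
  have hs3 : Real.log (Real.Gamma (x - 1)) = Real.log (Real.Gamma x) - Real.log (x - 1) := by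
    linarith
  rw [hs3] at hlo'
  have hm : Real.log (x - 1) ≤ Real.log x := Real.log_le_log (by linarith) (by linarith)
  rw [one_mul, Real.norm_eq_abs, Real.norm_eq_abs, ← sub_eq_add_neg,
    abs_of_nonpos (by linarith : Real.log (x - 1) - Real.log x ≤ 0), abs_le]
  constructor <;> nlinarith

lemma aux_shift (a : ℝ) :
    (fun x : ℝ => (Real.log (Real.Gamma (x + (a + 1))) - Real.log (Real.Gamma x)
        - (a + 1) * Real.log x) -
      (Real.log (Real.Gamma (x + a)) - Real.log (Real.Gamma x) - a * Real.log x))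
      =O[atTop] (fun x : ℝ => x⁻¹) := by
  refine (aux_log a).congr' ?_ EventuallyEq.rfl
  filter_upwards [eventually_gt_atTop (-a)] with x hx
  rw [← add_assoc, aux_Gamma_step (by linarith : 0 < x + a)]
  ring

lemma aux_all (a : ℝ) :
    (fun x : ℝ => Real.log (Real.Gamma (x + a)) - Real.log (Real.Gamma x) - a * Real.log x)
      =O[atTop] (fun x : ℝ => x⁻¹) := by
  have key : ∀ n : ℤ, (fun x : ℝ => Real.log (Real.Gamma (x + (Int.fract a + n)))
      - Real.log (Real.Gamma x) - (Int.fract a + n) * Real.log x)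
      =O[atTop] (fun x : ℝ => x⁻¹) := by
    intro n
    induction n using Int.induction_on with
    | zero => simpa using aux_unit (Int.fract a) (Int.fract_nonneg a) (Int.fract_lt_one a).le
    | succ i ih =>
      have := (aux_shift (Int.fract a + (i : ℤ))).add ih
      simp only [sub_add_cancel] at this
      simpa [add_assoc] using this
    | pred i ih =>
      have e : Int.fract a + ((-(i:ℤ) : ℤ) : ℝ) = Int.fract a + ((-(i:ℤ) - 1 : ℤ) : ℝ) + 1 := by
        push_cast; ring
      rw [e] at ih
      have := ih.sub (aux_shift (Int.fract a + ((-(i:ℤ) - 1 : ℤ) : ℝ)))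
      simpa only [sub_sub_cancel] using this
  have := key ⌊a⌋
  rwa [Int.fract_add_floor] at this

/-- Stirling-type estimate: as `x → +∞`,
`log A(x) = (Σα_j − Σβ_j)·log x + O(1/x)`, and `A(x) > 0` for large `x`. -/
theorem stmt7 (r : ℕ) (α β : Fin r → ℝ) :
    (∀ᶠ x : ℝ in atTop, 0 < hgAReal r α β x) ∧
    (fun x : ℝ => Real.log (hgAReal r α β x) - ((∑ j, α j) - ∑ j, β j) * Real.log x)
      =O[atTop] (fun x : ℝ => x⁻¹) := by
  have hpos : ∀ γ : Fin r → ℝ, ∀ᶠ x : ℝ in atTop, ∀ j, 0 < Real.Gamma (x + γ j) := by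
    intro γ
    rw [eventually_all]
    intro j
    filter_upwards [eventually_gt_atTop (-γ j)] with x hx
    exact Real.Gamma_pos_of_pos (by linarith)
  constructor
  · filter_upwards [hpos α, hpos β] with x ha hb
    exact div_pos (prod_pos fun j _ => ha j) (prod_pos fun j _ => hb j)
  · have h := IsBigO.sum (s := (univ : Finset (Fin r)))
      (fun j _ => (aux_all (α j)).sub (aux_all (β j)))
    refine h.congr' ?_ EventuallyEq.rfl
    filter_upwards [hpos α, hpos β] with x ha hb
    rw [hgAReal, Real.log_div (prod_pos fun j _ => ha j).ne' (prod_pos fun j _ => hb j).ne',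
      Real.log_prod (fun j _ => (ha j).ne'), Real.log_prod (fun j _ => (hb j).ne')]
    simp only [Finset.sum_apply, Finset.sum_sub_distrib, sub_mul, Finset.sum_mul]
    ring
end

section
/- Let a ≥ 0, let f : ℂ → ℂ be a function, and let p_0,…,p_a be complex polynomials, not all zero, such that Σ_{j=0}^a p_j(−s−j)·f(s+j) = 0 for all s ∈ ℂ. Let g be a nonzero complex polynomial. Define q_j(X) = p_j(X) · ∏_{0 ≤ k ≤ a, k ≠ j} g(−X−j+k) for 0 ≤ j ≤ a. Then the polynomials q_0,…,q_a are not all zero and Σ_{j=0}^a q_j(−s−j)·g(s+j)·f(s+j) = 0 for all s ∈ ℂ. In particular, if f satisfies a difference equation of length a, then so does the product g·f. -/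
open Finset Polynomial

/-- If `f` satisfies the difference equation `Σ_{j=0}^a p_j(−s−j) f(s+j) = 0` and `g`
is a nonzero polynomial, then `g·f` satisfies the difference equation of the same
length given by `q_j(X) = p_j(X) · ∏_{k≠j} g(−X−j+k)`. -/
theorem stmt13 (a : ℕ) (f : ℂ → ℂ) (p : ℕ → Polynomial ℂ)
    (hp : ∃ j ≤ a, p j ≠ 0)
    (hfe : ∀ s : ℂ, ∑ j ∈ range (a + 1), (p j).eval (-s - (j : ℂ)) * f (s + (j : ℂ)) = 0)
    (g : Polynomial ℂ) (hg : g ≠ 0)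
    (q : ℕ → Polynomial ℂ)
    (hq : ∀ j : ℕ, q j = p j * ∏ k ∈ (range (a + 1)).erase j,
      g.comp (-Polynomial.X + Polynomial.C ((k : ℂ) - (j : ℂ)))) :
    (∃ j ≤ a, q j ≠ 0) ∧
    ∀ s : ℂ, ∑ j ∈ range (a + 1),
      (q j).eval (-s - (j : ℂ)) * (g.eval (s + (j : ℂ)) * f (s + (j : ℂ))) = 0 := by
  obtain ⟨j, hj, hpj⟩ := hp
  refine ⟨⟨j, hj, ?_⟩, fun s => ?_⟩
  · rw [hq]
    refine mul_ne_zero hpj (Finset.prod_ne_zero_iff.mpr fun k _ h => ?_)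
    rcases Polynomial.comp_eq_zero_iff.mp h with h | ⟨_, h⟩
    · exact hg h
    · have := congrArg (fun r => Polynomial.coeff r 1) h
      simp [Polynomial.coeff_C] at this
  · have key : ∀ i ∈ range (a + 1),
        (q i).eval (-s - (i : ℂ)) * (g.eval (s + (i : ℂ)) * f (s + (i : ℂ))) =
        (∏ k ∈ range (a + 1), g.eval (s + (k : ℂ))) *
          ((p i).eval (-s - (i : ℂ)) * f (s + (i : ℂ))) := by
      intro i hi
      have h1 : ∀ k : ℕ, (g.comp (-Polynomial.X + Polynomial.C ((k : ℂ) - (i : ℂ)))).eval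
          (-s - (i : ℂ)) = g.eval (s + (k : ℂ)) := by
        intro k
        rw [Polynomial.eval_comp]
        congr 1
        simp only [Polynomial.eval_add, Polynomial.eval_neg, Polynomial.eval_X,
          Polynomial.eval_C]
        ring
      rw [hq, Polynomial.eval_mul, Polynomial.eval_prod, ← Finset.mul_prod_erase _ _ hi,
        Finset.prod_congr rfl fun k _ => h1 k]
      ring
    rw [Finset.sum_congr rfl key, ← Finset.mul_sum, hfe, mul_zero]
end

section
/- Let a ≥ 0 and let p_0,…,p_a be complex polynomials with p_0 ≠ 0. In the field ℂ(s) of rational functions over ℂ, define a sequence (a_n)_{n≥0} by a_0 = 1 and, for n ≥ 1, a_n = −p_0(s+n)^{−1} · Σ_{j=1}^{min(n,a)} p_j(s+n−j)·a_{n−j} (here p(s+k) denotes the image in ℂ(s) of the polynomial p composed with X+k; note p_0(s+n) ≠ 0 in ℂ(s)). Then for every n ≥ 0 the element a_n · ∏_{k=1}^{n} p_0(s+k) of ℂ(s) is a polynomial, i.e. lies in the image of ℂ[s] in ℂ(s). -/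
open Finset Polynomial

/-- The Frobenius-method coefficients `a_n ∈ ℂ(s)`, defined by `a_0 = 1` and
`a_n = −p_0(s+n)⁻¹ Σ_{j=1}^{min(n,d)} p_j(s+n−j) a_{n−j}`, have denominators
dividing `p_0(s+1)⋯p_0(s+n)`: the product `a_n · ∏_{k=1}^n p_0(s+k)` is a
polynomial. -/
theorem stmt14 (d : ℕ) (p : ℕ → Polynomial ℂ) (hp0 : p 0 ≠ 0)
    (u : ℕ → RatFunc ℂ)
    (hu0 : u 0 = 1)
    (hu : ∀ n : ℕ, 1 ≤ n → u n =
      -(algebraMap (Polynomial ℂ) (RatFunc ℂ) ((p 0).comp (X + C (n : ℂ))))⁻¹ *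
        ∑ j ∈ Finset.Icc 1 (min n d),
          algebraMap (Polynomial ℂ) (RatFunc ℂ)
              ((p j).comp (X + C ((n - j : ℕ) : ℂ))) * u (n - j)) :
    ∀ n : ℕ, ∃ q : Polynomial ℂ,
      u n * ∏ k ∈ Finset.Icc 1 n,
          algebraMap (Polynomial ℂ) (RatFunc ℂ) ((p 0).comp (X + C (k : ℂ))) =
        algebraMap (Polynomial ℂ) (RatFunc ℂ) q := by
  set A := algebraMap (Polynomial ℂ) (RatFunc ℂ) with hA
  intro n
  suffices h : u n * ∏ k ∈ Finset.Icc 1 n, A ((p 0).comp (X + C (k : ℂ))) ∈ A.range by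
    obtain ⟨q, hq⟩ := h
    exact ⟨q, hq.symm⟩
  induction n using Nat.strong_induction_on with
  | _ n ih =>
    rcases n with _ | n
    · simpa [hu0] using A.range.one_mem
    · rw [Finset.prod_Icc_succ_top (by omega), hu (n + 1) (by omega)]
      by_cases hP : A ((p 0).comp (X + C ((n + 1 : ℕ) : ℂ))) = 0
      · rw [hP]
        simpa using A.range.zero_mem
      · have key : ∀ (P S Q : RatFunc ℂ), P ≠ 0 → -P⁻¹ * S * (Q * P) = -(S * Q) := by
          intro P S Q h
          field_simp
        rw [key _ _ _ hP, Finset.sum_mul]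
        refine A.range.neg_mem (A.range.sum_mem ?_)
        intro j hj
        have hj1 := (Finset.mem_Icc.mp hj).1
        have hsub : Finset.Icc 1 (n + 1 - j) ⊆ Finset.Icc 1 n :=
          Finset.Icc_subset_Icc le_rfl (by omega)
        rw [← Finset.prod_sdiff hsub, mul_assoc, mul_left_comm (u _)]
        refine A.range.mul_mem ⟨_, rfl⟩ (A.range.mul_mem ?_ (ih _ (by omega)))
        exact A.range.prod_mem fun k _ => ⟨_, rfl⟩
end
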